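/- (Conjecture of Défago and Konagaya.) For every circle C of the plane and every even n = 2p with p ≥ 2, there exists no similarity-equivariant deterministic oblivious algorithm A that solves UTP on C in finite time; i.e., no such algorithm guarantees, for every initial configuration of n distinct points on C and every fair schedule, that all robots remain on C at all times and that the positions form a regular n-gon at some time. -/

import Mathlib

open Real

/-- The consecutive central gaps of angles `θ 0 < θ 1 < ⋯ < θ (n-1) < θ 0 + 2π`. -/
noncomputable def gap (n : ℕ) (θ : Fin n → ℝ) (i : Fin n) : ℝ :=
  if h : (i : ℕ) + 1 < n then θ ⟨(i : ℕ) + 1, h⟩ - θ i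
  else θ ⟨0, i.pos⟩ + 2 * π - θ i

/-- A similarity of the plane (identified with `ℂ`): `f x = s • L x + v` with `s > 0`
and `L` a linear isometry. -/
def IsSimilarity (f : ℂ → ℂ) : Prop :=
  ∃ (s : ℝ) (L : ℂ ≃ₗᵢ[ℝ] ℂ) (v : ℂ), 0 < s ∧ ∀ x, f x = s • L x + v

/-- A deterministic oblivious algorithm is similarity-equivariant if it commutes with
every similarity of the plane. -/
def Equivariant (A : ℂ → Multiset ℂ → ℂ) : Prop :=
  ∀ f : ℂ → ℂ, IsSimilarity f → ∀ (x : ℂ) (m : Multiset ℂ),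
    A (f x) (Multiset.map f m) = f (A x m)

open scoped Classical

/-- The execution of algorithm `A` from initial configuration `x₀` under schedule `S`:
at each step, exactly the robots in `S t` apply `A` to their own position and the
multiset of all current positions; the others stay put. -/
noncomputable def exec (n : ℕ) (A : ℂ → Multiset ℂ → ℂ) (x₀ : Fin n → ℂ)
    (S : ℕ → Set (Fin n)) : ℕ → Fin n → ℂ
  | 0 => x₀
  | t + 1 => fun i =>
      if i ∈ S t then
        A (exec n A x₀ S t i) (Multiset.map (exec n A x₀ S t) Finset.univ.val)
      else exec n A x₀ S t i

/-- A fair schedule: every step activates a nonempty set of robots, and every robot is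
activated infinitely often. -/
def FairSchedule (n : ℕ) (S : ℕ → Set (Fin n)) : Prop :=
  (∀ t, (S t).Nonempty) ∧ ∀ (i : Fin n) (T : ℕ), ∃ t, T ≤ t ∧ i ∈ S t

/-- The positions form a regular `n`-gon on the circle of center `c` and radius `ρ`:
up to a permutation, they are the points of angles `φ + 2πk/n`, `k ∈ Fin n`. -/
def FormsRegularNgon (n : ℕ) (c : ℂ) (ρ : ℝ) (pos : Fin n → ℂ) : Prop :=
  ∃ (φ : ℝ) (σ : Equiv.Perm (Fin n)), ∀ i : Fin n,
    pos (σ i) = c + (ρ : ℂ) * Complex.exp (((φ + 2 * π * ((i : ℕ) : ℝ) / n : ℝ) : ℂ) * Complex.I)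

/-- `A` solves the Uniform Transformation Problem on the circle of center `c` and
radius `ρ` in finite time: from every configuration of `n` distinct points of the
circle and under every fair schedule, all robots stay on the circle forever and at
some time the positions form a regular `n`-gon. -/
def SolvesUTP (n : ℕ) (c : ℂ) (ρ : ℝ) (A : ℂ → Multiset ℂ → ℂ) : Prop :=
  ∀ x₀ : Fin n → ℂ, Function.Injective x₀ → (∀ i, x₀ i ∈ Metric.sphere c ρ) →
    ∀ S : ℕ → Set (Fin n), FairSchedule n S →
      (∀ t i, exec n A x₀ S t i ∈ Metric.sphere c ρ) ∧
      ∃ t, FormsRegularNgon n c ρ (exec n A x₀ S t)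

/-- A strict biangular configuration on the circle of center `c` and radius `ρ`:
`n` points of the circle whose consecutive central gaps, in cyclic angular order,
alternate between two positive values `α ≠ β`. -/
def IsStrictBiangularOn (n : ℕ) (c : ℂ) (ρ : ℝ) (P : Multiset ℂ) : Prop :=
  ∃ (θ : Fin n → ℝ) (α β : ℝ), α ≠ β ∧ 0 < α ∧ 0 < β ∧ StrictMono θ ∧
    (∀ i : Fin n, gap n θ i = if (i : ℕ) % 2 = 0 then α else β) ∧
    P = Multiset.map (fun i => c + (ρ : ℂ) * Complex.exp (((θ i : ℝ) : ℂ) * Complex.I))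
          Finset.univ.val

/-- The configuration obtained from `x` when exactly the robots in `s` apply `A`. -/
noncomputable def roundStep {n : ℕ} (A : ℂ → Multiset ℂ → ℂ) (x : Fin n → ℂ)
    (s : Set (Fin n)) : Fin n → ℂ :=
  fun i => if i ∈ s then A (x i) (Multiset.map x Finset.univ.val) else x i

/-- The robots whose index has parity `b`. -/
def parityClass (n b : ℕ) : Set (Fin n) := {i | (i : ℕ) % 2 = b}

/-- An adversary that activates the parity classes alternately whenever this preserves `I`,
and all robots otherwise. -/
lemma exists_adversary_schedule {n : ℕ} (hn : 2 ≤ n) (A : ℂ → Multiset ℂ → ℂ)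
    (I : (Fin n → ℂ) → Prop) (x₀ : Fin n → ℂ) :
    ∃ S : ℕ → Set (Fin n), FairSchedule n S ∧ ∀ t,
      I (exec n A x₀ S (t + 1)) ∨
      (¬ I (roundStep A (exec n A x₀ S t) (parityClass n (t % 2))) ∧
        exec n A x₀ S (t + 1) = roundStep A (exec n A x₀ S t) Set.univ) := by
  let choice : ℕ → (Fin n → ℂ) → Set (Fin n) := fun t x =>
    if I (roundStep A x (parityClass n (t % 2))) then parityClass n (t % 2) else Set.univ
  let X : ℕ → Fin n → ℂ := fun t =>
    Nat.rec x₀ (fun t x => roundStep A x (choice t x)) t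
  let S : ℕ → Set (Fin n) := fun t => choice t (X t)
  have hX : ∀ t, exec n A x₀ S t = X t := by
    intro t
    induction t with
    | zero => rfl
    | succ t ih =>
      funext i
      simp only [exec, ih]
      rfl
  have hsub : ∀ t, parityClass n (t % 2) ⊆ S t := by
    intro t
    change _ ⊆ choice t (X t)
    simp only [choice]
    split_ifs
    · exact subset_rfl
    · exact Set.subset_univ _
  refine ⟨S, ⟨fun t => ⟨⟨t % 2, by omega⟩, hsub t ?_⟩, fun i T => ?_⟩, fun t => ?_⟩
  · simp [parityClass]
  · by_cases h : (i : ℕ) % 2 = T % 2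
    · exact ⟨T, le_rfl, hsub T h⟩
    · exact ⟨T + 1, by omega, hsub (T + 1) (show (i : ℕ) % 2 = (T + 1) % 2 by omega)⟩
  · have hstep : exec n A x₀ S (t + 1) = roundStep A (exec n A x₀ S t) (S t) := rfl
    have hSt : S t = choice t (exec n A x₀ S t) := by rw [hX]
    rw [hstep, hSt]
    simp only [choice]
    split_ifs with h
    · exact Or.inl h
    · exact Or.inr ⟨h, rfl⟩

/-- The standard primitive `p`-th root of unity. -/
noncomputable def stdRoot (p : ℕ) : ℂ := Complex.exp (2 * π * Complex.I / p)

lemma stdRoot_isPrimitiveRoot {p : ℕ} (hp : 0 < p) : IsPrimitiveRoot (stdRoot p) p :=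
  Complex.isPrimitiveRoot_exp p hp.ne'

lemma norm_stdRoot {p : ℕ} (hp : 0 < p) : ‖stdRoot p‖ = 1 :=
  (stdRoot_isPrimitiveRoot hp).norm'_eq_one hp.ne'

/-- Robots of even index form the regular `p`-gon of center `c` through `c + u`, those of odd
index the one through `c + v`. -/
noncomputable def biangularPos (p n : ℕ) (c u v : ℂ) (i : Fin n) : ℂ :=
  c + (if (i : ℕ) % 2 = 0 then u else v) * stdRoot p ^ ((i : ℕ) / 2)

/-- Two concentric regular `p`-gons on the circle that do not form a regular `2p`-gon. -/
def UnbalancedBiangular (p n : ℕ) (c : ℂ) (ρ : ℝ) (x : Fin n → ℂ) : Prop :=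
  ∃ u v : ℂ, ‖u‖ = ρ ∧ ‖v‖ = ρ ∧ x = biangularPos p n c u v ∧ u ^ p + v ^ p ≠ 0

lemma biangularPos_sub_pow {p n : ℕ} (hp : 0 < p) (c u v : ℂ) (i : Fin n) :
    (biangularPos p n c u v i - c) ^ p = if (i : ℕ) % 2 = 0 then u ^ p else v ^ p := by
  have h : (stdRoot p ^ ((i : ℕ) / 2)) ^ p = 1 := by
    rw [pow_right_comm, (stdRoot_isPrimitiveRoot hp).pow_eq_one, one_pow]
  rw [biangularPos, add_sub_cancel_left, mul_pow, h, mul_one]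
  split_ifs <;> rfl

lemma norm_biangularPos_sub {p n : ℕ} (hp : 0 < p) {c u v : ℂ} {ρ : ℝ} (hu : ‖u‖ = ρ)
    (hv : ‖v‖ = ρ) (i : Fin n) : ‖biangularPos p n c u v i - c‖ = ρ := by
  rw [biangularPos, add_sub_cancel_left, norm_mul, norm_pow, norm_stdRoot hp, one_pow, mul_one]
  split_ifs <;> assumption

lemma exists_initial_unbalanced {p : ℕ} (hp : 0 < p) (c : ℂ) {ρ : ℝ} (hρ : 0 < ρ) :
    ∃ x₀ : Fin (2 * p) → ℂ, Function.Injective x₀ ∧ (∀ i, x₀ i ∈ Metric.sphere c ρ) ∧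
      UnbalancedBiangular p (2 * p) c ρ x₀ := by
  have hρc : (ρ : ℂ) ≠ 0 := by exact_mod_cast hρ.ne'
  have hpc : (p : ℂ) ≠ 0 := by exact_mod_cast hp.ne'
  set w : ℂ := Complex.exp ((π / 2 / p : ℝ) * Complex.I) with hw
  have hwp : w ^ p = Complex.I := by
    rw [hw, ← Complex.exp_nat_mul]
    refine Eq.trans (congrArg Complex.exp ?_) Complex.exp_pi_div_two_mul_I
    push_cast
    field_simp
  have hu : ‖(ρ : ℂ)‖ = ρ := by simp [hρ.le]
  have hv : ‖(ρ : ℂ) * w‖ = ρ := by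
    rw [norm_mul, hu, hw, Complex.norm_exp_ofReal_mul_I, mul_one]
  have hvp : ((ρ : ℂ) * w) ^ p = ρ ^ p * Complex.I := by rw [mul_pow, hwp]
  have hne : (ρ : ℂ) ^ p ≠ ρ ^ p * Complex.I := by
    intro h
    have : Complex.I = 1 := mul_left_cancel₀ (pow_ne_zero p hρc) (by rw [← h, mul_one])
    simpa using congrArg Complex.re this
  refine ⟨biangularPos p (2 * p) c ρ (ρ * w), ?_, ?_, ρ, ρ * w, hu, hv, rfl, ?_⟩
  · intro i j hij
    have hpar : (i : ℕ) % 2 = 0 ↔ (j : ℕ) % 2 = 0 := by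
      have h := congrArg (fun z => (z - c) ^ p) hij
      simp only [biangularPos_sub_pow hp, hvp] at h
      split_ifs at h with hi hj hj
      · exact iff_of_true hi hj
      · exact absurd h hne
      · exact absurd h.symm hne
      · exact iff_of_false hi hj
    have hk : (i : ℕ) / 2 = (j : ℕ) / 2 := by
      have hz : (if (j : ℕ) % 2 = 0 then (ρ : ℂ) else ρ * w) ≠ 0 := by
        split_ifs
        · exact hρc
        · exact mul_ne_zero hρc (Complex.exp_ne_zero _)
      rw [biangularPos, biangularPos, if_congr hpar rfl rfl] at hij
      exact (stdRoot_isPrimitiveRoot hp).pow_inj (by omega) (by omega)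
        (mul_left_cancel₀ hz (add_left_cancel hij))
    ext
    omega
  · intro i
    rw [mem_sphere_iff_norm]
    exact norm_biangularPos_sub hp hu hv i
  · intro h
    rw [hvp, ← mul_one_add] at h
    rcases mul_eq_zero.mp h with h | h
    · exact pow_ne_zero p hρc h
    · simpa using congrArg Complex.re h

lemma UnbalancedBiangular.not_formsRegularNgon {p : ℕ} {c : ℂ} {ρ : ℝ}
    {x : Fin (2 * p) → ℂ} (h : UnbalancedBiangular p (2 * p) c ρ x) (hp : 0 < p)
    (hρ : 0 < ρ) : ¬ FormsRegularNgon (2 * p) c ρ x := by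
  rintro ⟨φ, σ, hσ⟩
  obtain ⟨u, v, -, -, rfl, huv⟩ := h
  have hρc : (ρ : ℂ) ≠ 0 := by exact_mod_cast hρ.ne'
  have hpc : (p : ℂ) ≠ 0 := by exact_mod_cast hp.ne'
  set a : ℂ := (ρ * Complex.exp (φ * Complex.I)) ^ p with ha
  have ha0 : a ≠ 0 := pow_ne_zero _ (mul_ne_zero hρc (Complex.exp_ne_zero _))
  have h0 : (biangularPos p (2 * p) c u v (σ ⟨0, by omega⟩) - c) ^ p = a := by
    rw [hσ, add_sub_cancel_left, ha]
    simp
  have h1 : (biangularPos p (2 * p) c u v (σ ⟨1, by omega⟩) - c) ^ p = -a := by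
    rw [hσ, add_sub_cancel_left, ha, mul_pow, mul_pow, ← Complex.exp_nat_mul,
      ← Complex.exp_nat_mul, ← mul_neg, ← neg_one_mul, ← Complex.exp_pi_mul_I, ← Complex.exp_add]
    congr 2
    push_cast
    field_simp
    ring
  rw [biangularPos_sub_pow hp] at h0 h1
  have hne : a ≠ -a := fun h => ha0 (self_eq_neg.mp h)
  split_ifs at h0 h1
  · exact hne (h0.symm.trans h1)
  · exact huv (by rw [h0, h1, add_neg_cancel])
  · exact huv (by rw [h0, h1, neg_add_cancel])
  · exact hne (h0.symm.trans h1)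

lemma isSimilarity_rotation (c : ℂ) {a : ℂ} (ha : ‖a‖ = 1) :
    IsSimilarity fun z => c + a * (z - c) := by
  refine ⟨1, rotation ⟨a, mem_sphere_zero_iff_norm.mpr ha⟩, c - a * c, one_pos, fun x => ?_⟩
  change _ = (1 : ℝ) • (a * x) + _
  rw [one_smul]
  ring

lemma isSimilarity_reflection (c : ℂ) {a : ℂ} (ha : ‖a‖ = 1) :
    IsSimilarity fun z => c + a * starRingEnd ℂ (z - c) := by
  refine ⟨1, Complex.conjLIE.trans (rotation ⟨a, mem_sphere_zero_iff_norm.mpr ha⟩),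
    c - a * starRingEnd ℂ c, one_pos, fun x => ?_⟩
  change _ = (1 : ℝ) • (a * starRingEnd ℂ x) + _
  rw [one_smul]
  simp only [map_sub]
  ring

/-- If a similarity permutes the robots of a configuration, it commutes with their moves. -/
lemma Equivariant.apply_of_perm {A : ℂ → Multiset ℂ → ℂ} (hA : Equivariant A) {f : ℂ → ℂ}
    (hf : IsSimilarity f) {n : ℕ} {x : Fin n → ℂ} (e : Equiv.Perm (Fin n))
    (he : ∀ i, f (x i) = x (e i)) (y : ℂ) :
    A (f y) (Multiset.map x Finset.univ.val) = f (A y (Multiset.map x Finset.univ.val)) := by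
  have h : Multiset.map f (Multiset.map x Finset.univ.val) = Multiset.map x Finset.univ.val := by
    have hfx : f ∘ x = x ∘ e := funext he
    rw [Multiset.map_map, hfx, ← Multiset.map_map]
    congr 1
    simp
  have hAf := hA f hf y (Multiset.map x Finset.univ.val)
  rwa [h] at hAf

/-- In a biangular configuration all robots of even index turn by one common factor `μ`, and
those of odd index by its conjugate. -/
lemma Equivariant.exists_turn {A : ℂ → Multiset ℂ → ℂ} (hA : Equivariant A) {p : ℕ}
    (hp : 0 < p) (c : ℂ) {u v : ℂ} {ρ : ℝ} (hρ : 0 < ρ) (hu : ‖u‖ = ρ) (hv : ‖v‖ = ρ) :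
    ∃ μ : ℂ, ∀ i : Fin (2 * p),
      A (biangularPos p (2 * p) c u v i)
        (Multiset.map (biangularPos p (2 * p) c u v) Finset.univ.val) =
      c + (if (i : ℕ) % 2 = 0 then μ else starRingEnd ℂ μ) *
        (biangularPos p (2 * p) c u v i - c) := by
  have hu0 : u ≠ 0 := norm_pos_iff.mp (hu ▸ hρ)
  have hv0 : v ≠ 0 := norm_pos_iff.mp (hv ▸ hρ)
  have hω := stdRoot_isPrimitiveRoot hp
  have hω1 := norm_stdRoot hp
  have hω0 : stdRoot p ≠ 0 := hω.ne_zero hp.ne'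
  have hconj : starRingEnd ℂ (stdRoot p) = (stdRoot p)⁻¹ := (Complex.inv_eq_conj hω1).symm
  have hcu : starRingEnd ℂ u = (ρ : ℂ) ^ 2 / u := by
    rw [eq_div_iff hu0, mul_comm, Complex.mul_conj', hu]
  have hcv : starRingEnd ℂ v = (ρ : ℂ) ^ 2 / v := by
    rw [eq_div_iff hv0, mul_comm, Complex.mul_conj', hv]
  have hρc : (ρ : ℂ) ≠ 0 := by exact_mod_cast hρ.ne'
  set x := biangularPos p (2 * p) c u v with hx
  set m := Multiset.map x Finset.univ.val
  have hrot : ∀ y, A (c + stdRoot p * (y - c)) m = c + stdRoot p * (A y m - c) := by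
    have : NeZero (2 * p) := ⟨by omega⟩
    refine hA.apply_of_perm (isSimilarity_rotation c hω1) (Equiv.addRight 2) fun i => ?_
    have hval : ((i + 2 : Fin (2 * p)) : ℕ) = ((i : ℕ) + 2) % (2 * p) := by
      simp [Fin.val_add]
    have hpar : ((i : ℕ) + 2) % (2 * p) % 2 = (i : ℕ) % 2 := by
      rw [Nat.mod_mul_right_mod]; omega
    have hhalf : stdRoot p ^ (((i : ℕ) + 2) % (2 * p) / 2) =
        stdRoot p * stdRoot p ^ ((i : ℕ) / 2) := by
      rw [Nat.mod_mul_right_div_self, ← pow_succ',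
        show ((i : ℕ) + 2) / 2 = (i : ℕ) / 2 + 1 by omega]
      exact (pow_eq_pow_mod _ hω.pow_eq_one).symm
    simp only [hx, biangularPos, Equiv.coe_addRight, hval, hpar, hhalf]
    ring
  have hrotk : ∀ (k : ℕ) (y : ℂ),
      A (c + stdRoot p ^ k * y) m = c + stdRoot p ^ k * (A (c + y) m - c) := by
    intro k y
    induction k with
    | zero => simp
    | succ k ih =>
      have h := hrot (c + stdRoot p ^ k * y)
      rw [ih, add_sub_cancel_left, add_sub_cancel_left] at h
      rw [pow_succ', mul_assoc, h, mul_assoc]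
  set a : ℂ := u * v * (stdRoot p)⁻¹ / ρ ^ 2 with ha
  have ha1 : ‖a‖ = 1 := by
    rw [ha, norm_div, norm_mul, norm_mul, norm_inv, hω1, hu, hv, norm_pow, Complex.norm_real,
      Real.norm_of_nonneg hρ.le]
    field_simp
  have hperm : ∀ i : Fin (2 * p), c + a * starRingEnd ℂ (x i - c) = x (Fin.rev i) := by
    intro i
    have hi := i.isLt
    have hpow : stdRoot p ^ ((Fin.rev i : ℕ) / 2) =
        (stdRoot p)⁻¹ * ((stdRoot p)⁻¹) ^ ((i : ℕ) / 2) := by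
      rw [← pow_succ', inv_pow, ← mul_eq_one_iff_eq_inv₀ (pow_ne_zero _ hω0), ← pow_add,
        Fin.val_rev, show (2 * p - ((i : ℕ) + 1)) / 2 + ((i : ℕ) / 2 + 1) = p by omega,
        hω.pow_eq_one]
    simp only [hx, biangularPos, hpow, add_sub_cancel_left, map_mul, map_pow, hconj, ha]
    by_cases h : (i : ℕ) % 2 = 0
    · have h' : ¬ (Fin.rev i : ℕ) % 2 = 0 := by rw [Fin.val_rev]; omega
      simp only [h, h', if_true, if_false, hcu]
      field_simp
    · have h' : (Fin.rev i : ℕ) % 2 = 0 := by rw [Fin.val_rev]; omega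
      simp only [h, h', if_true, if_false, hcv]
      field_simp
  have hrefl : ∀ y, A (c + a * starRingEnd ℂ (y - c)) m = c + a * starRingEnd ℂ (A y m - c) :=
    hA.apply_of_perm (isSimilarity_reflection c ha1) Fin.revPerm hperm
  have heven : ∀ i : Fin (2 * p), (i : ℕ) % 2 = 0 →
      A (x i) m = c + (A (c + u) m - c) / u * (x i - c) := by
    intro i hi
    have hxi : x i = c + stdRoot p ^ ((i : ℕ) / 2) * u := by
      simp only [hx, biangularPos, hi, if_true]
      ring
    rw [hxi, hrotk, add_sub_cancel_left]
    field_simp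
  refine ⟨(A (c + u) m - c) / u, fun i => ?_⟩
  split_ifs with hi
  · exact heven i hi
  · have h := hrefl (x (Fin.rev i))
    rw [hperm, Fin.rev_rev, heven (Fin.rev i) (by rw [Fin.val_rev]; omega), add_sub_cancel_left,
      map_mul] at h
    rw [h]
    have hxi := hperm (Fin.rev i)
    rw [Fin.rev_rev] at hxi
    rw [← hxi]
    ring

/-- If activating one parity class balances an unbalanced biangular configuration, then
activating all robots keeps it unbalanced. -/
lemma UnbalancedBiangular.step {p : ℕ} {c : ℂ} {ρ : ℝ} {x : Fin (2 * p) → ℂ}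
    (h : UnbalancedBiangular p (2 * p) c ρ x) (hp : 0 < p) {A : ℂ → Multiset ℂ → ℂ}
    (hA : Equivariant A) (hρ : 0 < ρ) {b : ℕ} (hb : b < 2)
    (hbad : ¬ UnbalancedBiangular p (2 * p) c ρ (roundStep A x (parityClass (2 * p) b)))
    (hon : ∀ i, roundStep A x Set.univ i ∈ Metric.sphere c ρ) :
    UnbalancedBiangular p (2 * p) c ρ (roundStep A x Set.univ) := by
  obtain ⟨u, v, hu, hv, rfl, huv⟩ := h
  obtain ⟨μ, hμ⟩ := hA.exists_turn hp c hρ hu hv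
  have hu0 : u ≠ 0 := norm_pos_iff.mp (hu ▸ hρ)
  have hv0 : v ≠ 0 := norm_pos_iff.mp (hv ▸ hρ)
  have hμ1 : ‖μ‖ = 1 := by
    have h := hon ⟨0, by omega⟩
    rw [mem_sphere_iff_norm, roundStep, if_pos (Set.mem_univ _), hμ, if_pos (Nat.zero_mod 2),
      add_sub_cancel_left, norm_mul, norm_biangularPos_sub hp hu hv] at h
    exact (mul_eq_right₀ hρ.ne').mp h
  have hμc : ‖starRingEnd ℂ μ‖ = 1 := by rw [RCLike.norm_conj, hμ1]
  have hinv : μ ^ p * starRingEnd ℂ μ ^ p = 1 := by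
    rw [← mul_pow, Complex.mul_conj', hμ1]
    simp
  have hall : roundStep A (biangularPos p (2 * p) c u v) Set.univ =
      biangularPos p (2 * p) c (μ * u) (starRingEnd ℂ μ * v) := by
    funext i
    rw [roundStep, if_pos (Set.mem_univ _), hμ]
    simp only [biangularPos]
    split_ifs <;> ring
  refine ⟨μ * u, starRingEnd ℂ μ * v, by rw [norm_mul, hμ1, hu, one_mul],
    by rw [norm_mul, hμc, hv, one_mul], hall, fun hzero => hbad ?_⟩
  rw [mul_pow, mul_pow] at hzero
  interval_cases b
  · refine ⟨μ * u, v, by rw [norm_mul, hμ1, hu, one_mul], hv, ?_, fun hhalf => huv ?_⟩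
    · funext i
      by_cases hi : (i : ℕ) % 2 = 0
      · rw [roundStep, if_pos (show i ∈ parityClass _ _ from hi), hμ]
        simp only [biangularPos, hi, if_true]
        ring
      · rw [roundStep, if_neg (show i ∉ parityClass _ _ from hi)]
        simp only [biangularPos, hi, if_false]
    · rw [mul_pow] at hhalf
      have hc : starRingEnd ℂ μ ^ p = 1 :=
        mul_right_cancel₀ (pow_ne_zero p hv0) (by linear_combination hzero - hhalf)
      rw [hc, mul_one] at hinv
      rw [hinv, one_mul] at hhalf
      exact hhalf
  · refine ⟨u, starRingEnd ℂ μ * v, hu, by rw [norm_mul, hμc, hv, one_mul], ?_,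
      fun hhalf => huv ?_⟩
    · funext i
      by_cases hi : (i : ℕ) % 2 = 0
      · rw [roundStep, if_neg (show i ∉ parityClass _ _ from by simp [parityClass, hi])]
        simp only [biangularPos, hi, if_true]
      · rw [roundStep, if_pos (show i ∈ parityClass _ _ from Nat.mod_two_ne_zero.mp hi), hμ]
        simp only [biangularPos, hi, if_false]
        ring
    · rw [mul_pow] at hhalf
      have hc : μ ^ p = 1 :=
        mul_right_cancel₀ (pow_ne_zero p hu0) (by linear_combination hzero - hhalf)
      rw [hc, one_mul] at hinv
      rw [hinv, one_mul] at hhalf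
      exact hhalf

/-- Conjecture of Défago and Konagaya: for every circle of the plane and every even
`n = 2p` with `p ≥ 2`, no similarity-equivariant deterministic oblivious algorithm
solves the Uniform Transformation Problem on that circle in finite time. -/
theorem defago_konagaya_conjecture (p n : ℕ) (hp : 2 ≤ p) (hnp : n = 2 * p)
    (c : ℂ) (ρ : ℝ) (hρ : 0 < ρ) :
    ∀ A : ℂ → Multiset ℂ → ℂ, Equivariant A → ¬ SolvesUTP n c ρ A := by
  intro A hA hsolve
  have hp0 : 0 < p := by omega
  subst hnp
  obtain ⟨x₀, hinj, hsphere, h0⟩ := exists_initial_unbalanced hp0 c hρ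
  obtain ⟨S, hfair, hS⟩ := exists_adversary_schedule (by omega) A
    (UnbalancedBiangular p (2 * p) c ρ) x₀
  obtain ⟨hon, t, ht⟩ := hsolve x₀ hinj hsphere S hfair
  have hinv : ∀ t, UnbalancedBiangular p (2 * p) c ρ (exec (2 * p) A x₀ S t) := by
    intro t
    induction t with
    | zero => exact h0
    | succ t ih =>
      rcases hS t with h | ⟨hbad, hall⟩
      · exact h
      · rw [hall]
        refine ih.step hp0 hA hρ (Nat.mod_lt t two_pos) hbad ?_
        intro i
        rw [← hall]
        exact hon (t + 1) i
  exact (hinv t).not_formsRegularNgon hp0 hρ ht
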